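/- arXiv:2009.10301 — 6 statements merged into one kernel-verified Lean document; each statement's English description precedes it below -/
import Mathlib

section
/- Fix integers n ≥ 2, h ≥ 1, points y₁,…,yₙ in ℝ^h, and target probabilities p : Fin n → Fin n → ℝ with pᵢᵢ = 0, pᵢⱼ > 0 for i ≠ j, and ∑_{j≠i} pᵢⱼ = 1 for every i. Define qᵢⱼ(y) = exp(−‖yᵢ−yⱼ‖²) / ∑_{k≠i} exp(−‖yᵢ−yₖ‖²) and the SNE cost c₁(y) = ∑ᵢ ∑_{j≠i} pᵢⱼ log(pᵢⱼ / qᵢⱼ(y)). Then for every index i, the gradient of the map u ↦ c₁(y with yᵢ replaced by u), evaluated at yᵢ, equals 2 ∑_{j=1}^n (pᵢⱼ − qᵢⱼ + pⱼᵢ − qⱼᵢ)(yᵢ − yⱼ), where qᵢⱼ is evaluated at the given y and pᵢᵢ = qᵢᵢ = 0. -/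
/-- SNE embedding-space probability: `q z i j = exp(-‖zᵢ-zⱼ‖²) / ∑_{k≠i} exp(-‖zᵢ-zₖ‖²)`,
with `q z i i = 0`. -/
noncomputable def sneQ {n h : ℕ} (z : Fin n → EuclideanSpace ℝ (Fin h))
    (i j : Fin n) : ℝ :=
  if i = j then 0
  else Real.exp (-‖z i - z j‖ ^ 2) /
    ∑ k ∈ Finset.univ.filter (fun k => k ≠ i), Real.exp (-‖z i - z k‖ ^ 2)

/-- SNE cost: sum of Kullback–Leibler divergences `c₁(z) = ∑ᵢ ∑_{j≠i} pᵢⱼ log(pᵢⱼ/qᵢⱼ(z))`. -/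
noncomputable def sneCost {n h : ℕ} (p : Fin n → Fin n → ℝ)
    (z : Fin n → EuclideanSpace ℝ (Fin h)) : ℝ :=
  ∑ i, ∑ j ∈ Finset.univ.filter (fun j => j ≠ i),
    p i j * Real.log (p i j / sneQ z i j)

/-- For fully supported targets with unit row sums, the SNE cost splits into a constant, a
weighted sum of squared distances and the log-partition functions. -/
lemma sneCost_eq {n h : ℕ} {p : Fin n → Fin n → ℝ} (hpos : ∀ i j, i ≠ j → 0 < p i j)
    (hsum : ∀ i, ∑ j ∈ Finset.univ.filter (fun j => j ≠ i), p i j = 1)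
    (z : Fin n → EuclideanSpace ℝ (Fin h)) :
    sneCost p z = ∑ a, (∑ j ∈ Finset.univ.filter (fun j => j ≠ a),
        (p a j * Real.log (p a j) + p a j * ‖z a - z j‖ ^ 2) +
      Real.log (∑ k ∈ Finset.univ.filter (fun k => k ≠ a), Real.exp (-‖z a - z k‖ ^ 2))) := by
  unfold sneCost
  refine Finset.sum_congr rfl fun a _ => ?_
  set S := ∑ k ∈ Finset.univ.filter (fun k => k ≠ a), Real.exp (-‖z a - z k‖ ^ 2) with hS
  rw [← one_mul (Real.log S), ← hsum a, Finset.sum_mul, ← Finset.sum_add_distrib]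
  refine Finset.sum_congr rfl fun j hj => ?_
  have hja : j ≠ a := (Finset.mem_filter.1 hj).2
  have hSpos : 0 < S := Finset.sum_pos (fun _ _ => Real.exp_pos _) ⟨j, hj⟩
  have hq : sneQ z a j = Real.exp (-‖z a - z j‖ ^ 2) / S := by
    simp only [sneQ, if_neg hja.symm, hS]
  rw [hq, Real.log_div (hpos a j hja.symm).ne' (by positivity),
    Real.log_div (Real.exp_pos _).ne' hSpos.ne', Real.log_exp]
  ring

/-- Derivative of a squared distance between two points of a configuration when the `i`-th
point moves. -/
lemma hasFDerivAt_norm_sub_sq_update {n h : ℕ} (y : Fin n → EuclideanSpace ℝ (Fin h))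
    (i a j : Fin n) :
    HasFDerivAt (fun u => ‖Function.update y i u a - Function.update y i u j‖ ^ 2)
      ((2 * ((if a = i then 1 else 0) - (if j = i then 1 else 0)) : ℝ) •
        innerSL ℝ (y a - y j)) (y i) := by
  have hcoord : ∀ b : Fin n, HasFDerivAt (fun u => Function.update y i u b)
      ((if b = i then 1 else 0 : ℝ) •
        ContinuousLinearMap.id ℝ (EuclideanSpace ℝ (Fin h))) (y i) := by
    intro b
    by_cases hb : b = i
    · subst hb
      simpa only [Function.update_self, if_true, one_smul] using! hasFDerivAt_id (𝕜 := ℝ) (y b)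
    · simp only [Function.update_of_ne hb, if_neg hb]
      exact (hasFDerivAt_const (𝕜 := ℝ) (y b) (y i)).congr_fderiv (by ext; simp)
  refine ((hcoord a).sub (hcoord j)).norm_sq.congr_fderiv ?_
  ext v
  simp only [Pi.sub_apply, Function.update_eq_self, ← sub_smul]
  simp
  ring

/-- Derivative of the SNE cost when the `i`-th embedding point moves. -/
lemma hasFDerivAt_sneCost_update {n h : ℕ} {p : Fin n → Fin n → ℝ}
    (hpos : ∀ i j, i ≠ j → 0 < p i j)
    (hsum : ∀ i, ∑ j ∈ Finset.univ.filter (fun j => j ≠ i), p i j = 1)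
    (y : Fin n → EuclideanSpace ℝ (Fin h)) (i : Fin n) :
    HasFDerivAt (fun u => sneCost p (Function.update y i u))
      (∑ a, ∑ j ∈ Finset.univ.filter (fun j => j ≠ a), (p a j - sneQ y a j) •
        ((2 * ((if a = i then 1 else 0) - (if j = i then 1 else 0)) : ℝ) •
          innerSL ℝ (y a - y j))) (y i) := by
  simp only [sneCost_eq hpos hsum]
  refine HasFDerivAt.fun_sum fun a _ => ?_
  have hS : (∑ k ∈ Finset.univ.filter (fun k => k ≠ a), Real.exp (-‖y a - y k‖ ^ 2)) ≠ 0 := by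
    refine (Finset.sum_pos (fun _ _ => Real.exp_pos _) ?_).ne'
    by_contra hne
    have := hsum a
    rw [Finset.not_nonempty_iff_eq_empty.1 hne, Finset.sum_empty] at this
    exact zero_ne_one this
  have hD := hasFDerivAt_norm_sub_sq_update y i a
  have h1 := HasFDerivAt.fun_sum (u := Finset.univ.filter (fun j => j ≠ a)) fun j _ =>
    ((hD j).const_mul (p a j)).const_add (p a j * Real.log (p a j))
  have h2 := (HasFDerivAt.fun_sum (u := Finset.univ.filter (fun j => j ≠ a)) fun j _ =>
    (hD j).neg.exp).log (by simpa using hS)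
  refine (h1.add h2).congr_fderiv ?_
  simp only [Function.update_eq_self, Pi.neg_apply]
  rw [Finset.smul_sum, ← Finset.sum_add_distrib]
  refine Finset.sum_congr rfl fun j hj => ?_
  have hja : a ≠ j := (Finset.mem_filter.1 hj).2.symm
  rw [sub_smul, sneQ, if_neg hja, smul_neg, smul_neg, ← sub_eq_add_neg, div_eq_inv_mul]
  exact congrArg₂ (· - ·) rfl (smul_smul _ _ _)

/-- The gradient of the SNE cost with respect to the embedding point `yᵢ` is
`2 ∑ⱼ (pᵢⱼ − qᵢⱼ + pⱼᵢ − qⱼᵢ)(yᵢ − yⱼ)`. -/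
theorem sne_gradient (n h : ℕ) (hn : 2 ≤ n) (hh : 1 ≤ h)
    (y : Fin n → EuclideanSpace ℝ (Fin h)) (p : Fin n → Fin n → ℝ)
    (hdiag : ∀ i, p i i = 0)
    (hpos : ∀ i j, i ≠ j → 0 < p i j)
    (hsum : ∀ i, ∑ j ∈ Finset.univ.filter (fun j => j ≠ i), p i j = 1)
    (i : Fin n) :
    gradient (fun u => sneCost p (Function.update y i u)) (y i) =
      (2 : ℝ) • ∑ j : Fin n,
        (p i j - sneQ y i j + p j i - sneQ y j i) • (y i - y j) := by
  refine HasGradientAt.gradient (hasGradientAt_iff_hasFDerivAt.2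
    ((hasFDerivAt_sneCost_update hpos hsum y i).congr_fderiv ?_))
  ext v
  have hfull : ∀ a, ∑ j ∈ Finset.univ.filter (fun j => j ≠ a), (p a j - sneQ y a j) *
      (2 * ((if a = i then 1 else 0) - (if j = i then 1 else 0)) * inner ℝ (y a - y j) v) =
      ∑ j, (p a j - sneQ y a j) *
      (2 * ((if a = i then 1 else 0) - (if j = i then 1 else 0)) * inner ℝ (y a - y j) v) := by
    intro a
    refine Finset.sum_subset (Finset.filter_subset _ _) fun j _ hj => ?_
    have hja : j = a := by simpa using hj
    simp [hja]
  simp only [sum_apply, smul_apply, innerSL_apply_apply,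
    smul_eq_mul, InnerProductSpace.toDual_apply_apply, real_inner_smul_left, sum_inner, hfull]
  have hsplit : ∀ a j, (p a j - sneQ y a j) *
      (2 * ((if a = i then 1 else 0) - (if j = i then 1 else 0)) * inner ℝ (y a - y j) v) =
      (if a = i then 2 * ((p a j - sneQ y a j) * inner ℝ (y a - y j) v) else 0) -
        (if j = i then 2 * ((p a j - sneQ y a j) * inner ℝ (y a - y j) v) else 0) := by
    intro a j
    split_ifs <;> ring
  simp only [hsplit, Finset.sum_sub_distrib, Finset.sum_ite_eq', Finset.mem_univ, if_true]
  rw [Finset.sum_comm]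
  simp only [Finset.sum_ite_eq', Finset.mem_univ, if_true]
  rw [← Finset.sum_sub_distrib, Finset.mul_sum]
  refine Finset.sum_congr rfl fun j _ => ?_
  rw [← neg_sub (y i) (y j), inner_neg_left]
  ring
end

section
/- Fix integers n ≥ 2, h ≥ 1, points y₁,…,yₙ in ℝ^h, and symmetric target probabilities p : Fin n → Fin n → ℝ with pᵢᵢ = 0, pᵢⱼ = pⱼᵢ, pᵢⱼ > 0 for i ≠ j, and ∑_{(i,j): i≠j} pᵢⱼ = 1. Define the symmetrically normalized probabilities qᵢⱼ(y) = exp(−‖yᵢ−yⱼ‖²) / ∑_{(k,l): k≠l} exp(−‖yₖ−yₗ‖²) and the symmetric SNE cost c₂(y) = ∑ᵢ ∑_{j≠i} pᵢⱼ log(pᵢⱼ / qᵢⱼ(y)). Then for every index i, the gradient of the map u ↦ c₂(y with yᵢ replaced by u), evaluated at yᵢ, equals 4 ∑_{j=1}^n (pᵢⱼ − qᵢⱼ)(yᵢ − yⱼ), where qᵢⱼ is evaluated at the given y and pᵢᵢ = qᵢᵢ = 0. -/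
/-- Symmetric SNE embedding-space probability:
`q z i j = exp(-‖zᵢ-zⱼ‖²) / ∑_{(k,l): k≠l} exp(-‖zₖ-zₗ‖²)`, with `q z i i = 0`. -/
noncomputable def symSneQ {n h : ℕ} (z : Fin n → EuclideanSpace ℝ (Fin h))
    (i j : Fin n) : ℝ :=
  if i = j then 0
  else Real.exp (-‖z i - z j‖ ^ 2) /
    ∑ k, ∑ l ∈ Finset.univ.filter (fun l => l ≠ k), Real.exp (-‖z k - z l‖ ^ 2)

/-- Symmetric SNE cost: `c₂(z) = ∑ᵢ ∑_{j≠i} pᵢⱼ log(pᵢⱼ/qᵢⱼ(z))`. -/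
noncomputable def symSneCost {n h : ℕ} (p : Fin n → Fin n → ℝ)
    (z : Fin n → EuclideanSpace ℝ (Fin h)) : ℝ :=
  ∑ i, ∑ j ∈ Finset.univ.filter (fun j => j ≠ i),
    p i j * Real.log (p i j / symSneQ z i j)

open Finset in
theorem sum_exp_neg_sq_dist_pos {n h : ℕ} (hn : 2 ≤ n)
    (z : Fin n → EuclideanSpace ℝ (Fin h)) :
    0 < ∑ k, ∑ l ∈ univ.filter (fun l => l ≠ k), Real.exp (-‖z k - z l‖ ^ 2) := by
  have : Nontrivial (Fin n) := Fin.nontrivial_iff_two_le.mpr hn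
  refine sum_pos (fun k _ => sum_pos (fun l _ => Real.exp_pos _) ?_) univ_nonempty
  obtain ⟨l, hl⟩ := exists_ne k
  exact ⟨l, by simpa using hl⟩

theorem hasFDerivAt_norm_sq_update_sub_update {ι E : Type*} [DecidableEq ι]
    [NormedAddCommGroup E] [InnerProductSpace ℝ E] (y : ι → E) (i k l : ι) :
    HasFDerivAt (fun u => ‖Function.update y i u k - Function.update y i u l‖ ^ 2)
      (innerSL ℝ ((2 * ((if k = i then 1 else 0) - (if l = i then 1 else 0)) : ℝ) • (y k - y l)))
      (y i) := by
  have key (k : ι) : HasFDerivAt (fun u => Function.update y i u k)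
      ((if k = i then 1 else 0 : ℝ) • ContinuousLinearMap.id ℝ E) (y i) := by
    by_cases hk : k = i
    · subst hk
      simpa using! hasFDerivAt_id (𝕜 := ℝ) (y k)
    · simpa [hk] using hasFDerivAt_const (𝕜 := ℝ) (y k) (y i)
  refine ((key k).fun_sub (key l)).norm_sq.congr_fderiv ?_
  ext v
  simp only [Function.update_eq_self, coe_innerSL_apply, real_inner_smul_left,
    smul_apply, ContinuousLinearMap.comp_apply, sub_apply,
    ContinuousLinearMap.id_apply, inner_sub_right, real_inner_smul_right, nsmul_eq_mul]
  push_cast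
  ring

open Finset in
theorem sum_sum_smul_ite_sub_ite_smul_sub {ι E : Type*} [Fintype ι] [DecidableEq ι]
    [AddCommGroup E] [Module ℝ E] (c : ι → ι → ℝ) (hc : ∀ k l, c k l = c l k)
    (y : ι → E) (i : ι) :
    ∑ k, ∑ l ∈ univ.filter (fun l => l ≠ k), c k l •
      ((2 * ((if k = i then 1 else 0) - (if l = i then 1 else 0)) : ℝ) • (y k - y l)) =
    (4 : ℝ) • ∑ j, c i j • (y i - y j) := by
  have hfilter (k : ι) : ∑ l ∈ univ.filter (fun l => l ≠ k), c k l •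
      ((2 * ((if k = i then 1 else 0) - (if l = i then 1 else 0)) : ℝ) • (y k - y l)) =
      ∑ l, c k l •
      ((2 * ((if k = i then 1 else 0) - (if l = i then 1 else 0)) : ℝ) • (y k - y l)) := by
    refine sum_filter_of_ne fun l _ hl hlk => hl ?_
    simp [hlk]
  have hterm (k l : ι) : c k l •
      ((2 * ((if k = i then 1 else 0) - (if l = i then 1 else 0)) : ℝ) • (y k - y l)) =
      (if k = i then (2 : ℝ) • c i l • (y i - y l) else 0) +
      (if l = i then (2 : ℝ) • c i k • (y i - y k) else 0) := by
    split_ifs with hk hl hl <;> subst_vars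
    · simp
    · module
    · rw [hc k l]
      module
    · simp
  simp only [hfilter]
  simp only [hterm, sum_add_distrib, sum_ite_irrel, sum_const_zero, sum_ite_eq', mem_univ,
    if_true, ← smul_sum]
  module

theorem symSneQ_comm {n h : ℕ} (z : Fin n → EuclideanSpace ℝ (Fin h)) (i j : Fin n) :
    symSneQ z i j = symSneQ z j i := by
  simp only [symSneQ, eq_comm (a := i), norm_sub_rev (z i)]

open Finset in
/-- The cost splits into the negative entropy of `p`, a weighted sum of squared distances and the
logarithm of the normalizing constant. -/
theorem symSneCost_eq {n h : ℕ} (hn : 2 ≤ n) (p : Fin n → Fin n → ℝ)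
    (hpos : ∀ i j, i ≠ j → 0 < p i j)
    (hsum : ∑ i, ∑ j ∈ univ.filter (fun j => j ≠ i), p i j = 1)
    (z : Fin n → EuclideanSpace ℝ (Fin h)) :
    symSneCost p z =
      (∑ i, ∑ j ∈ univ.filter (fun j => j ≠ i), p i j * Real.log (p i j)) +
      (∑ i, ∑ j ∈ univ.filter (fun j => j ≠ i), p i j * ‖z i - z j‖ ^ 2) +
      Real.log (∑ k, ∑ l ∈ univ.filter (fun l => l ≠ k), Real.exp (-‖z k - z l‖ ^ 2)) := by
  have hZ := sum_exp_neg_sq_dist_pos hn z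
  rw [← one_mul (Real.log (∑ k, _)), ← hsum]
  simp only [symSneCost, sum_mul, ← sum_add_distrib]
  refine sum_congr rfl fun i _ => sum_congr rfl fun j hj => ?_
  have hij : i ≠ j := (mem_filter.mp hj).2.symm
  rw [symSneQ, if_neg hij, Real.log_div (hpos i j hij).ne' (by positivity),
    Real.log_div (Real.exp_ne_zero _) hZ.ne', Real.log_exp]
  ring

/-- The gradient of the symmetric SNE cost with respect to the embedding point `yᵢ` is
`4 ∑ⱼ (pᵢⱼ − qᵢⱼ)(yᵢ − yⱼ)`. -/
theorem sym_sne_gradient (n h : ℕ) (hn : 2 ≤ n) (hh : 1 ≤ h)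
    (y : Fin n → EuclideanSpace ℝ (Fin h)) (p : Fin n → Fin n → ℝ)
    (hdiag : ∀ i, p i i = 0)
    (hsymm : ∀ i j, p i j = p j i)
    (hpos : ∀ i j, i ≠ j → 0 < p i j)
    (hsum : ∑ i, ∑ j ∈ Finset.univ.filter (fun j => j ≠ i), p i j = 1)
    (i : Fin n) :
    gradient (fun u => symSneCost p (Function.update y i u)) (y i) =
      (4 : ℝ) • ∑ j : Fin n, (p i j - symSneQ y i j) • (y i - y j) := by
  have hd (k l : Fin n) := hasFDerivAt_norm_sq_update_sub_update y i k l
  have hZ := sum_exp_neg_sq_dist_pos hn y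
  refine HasGradientAt.gradient ?_
  rw [hasGradientAt_iff_hasFDerivAt]
  simp only [symSneCost_eq hn p hpos hsum]
  have hexp := HasFDerivAt.fun_sum (u := Finset.univ) fun k _ =>
    HasFDerivAt.fun_sum (u := Finset.univ.filter (fun l => l ≠ k)) fun l _ => (hd k l).fun_neg.exp
  have hdist := HasFDerivAt.fun_sum (u := Finset.univ) fun k _ =>
    HasFDerivAt.fun_sum (u := Finset.univ.filter (fun l => l ≠ k)) fun l _ =>
      (hd k l).const_mul (p k l)
  have hcost := (hdist.const_add (∑ i, ∑ j ∈ Finset.univ.filter (fun j => j ≠ i),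
    p i j * Real.log (p i j))).fun_add (hexp.log (by simpa using hZ.ne'))
  refine hcost.congr_fderiv ?_
  rw [← sum_sum_smul_ite_sub_ite_smul_sub (fun k l => p k l - symSneQ y k l)
    (fun k l => by rw [hsymm, symSneQ_comm])]
  ext v
  simp only [Function.update_eq_self, InnerProductSpace.toDual_apply_apply, sum_inner,
    real_inner_smul_left, add_apply, smul_apply,
    sum_apply, neg_apply, coe_innerSL_apply, smul_eq_mul,
    Finset.mul_sum, ← Finset.sum_add_distrib]
  refine Finset.sum_congr rfl fun k _ => Finset.sum_congr rfl fun l hl => ?_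
  rw [symSneQ, if_neg (Finset.mem_filter.mp hl).2.symm]
  ring
end

section
/- Fix integers n ≥ 2, h ≥ 1, points y₁,…,yₙ in ℝ^h, and symmetric target probabilities p : Fin n → Fin n → ℝ with pᵢᵢ = 0, pᵢⱼ = pⱼᵢ, pᵢⱼ > 0 for i ≠ j, and ∑_{(i,j): i≠j} pᵢⱼ = 1. Define the Cauchy (Student-t with one degree of freedom) probabilities qᵢⱼ(y) = (1 + ‖yᵢ−yⱼ‖²)⁻¹ / ∑_{(k,l): k≠l} (1 + ‖yₖ−yₗ‖²)⁻¹ and the t-SNE cost c₃(y) = ∑ᵢ ∑_{j≠i} pᵢⱼ log(pᵢⱼ / qᵢⱼ(y)). Then for every index i, the gradient of the map u ↦ c₃(y with yᵢ replaced by u), evaluated at yᵢ, equals 4 ∑_{j=1}^n (pᵢⱼ − qᵢⱼ)(1 + ‖yᵢ−yⱼ‖²)⁻¹ (yᵢ − yⱼ), where qᵢⱼ is evaluated at the given y and pᵢᵢ = qᵢᵢ = 0. -/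
/-- t-SNE embedding-space probability (Cauchy / Student-t with one degree of freedom):
`q z i j = (1 + ‖zᵢ-zⱼ‖²)⁻¹ / ∑_{(k,l): k≠l} (1 + ‖zₖ-zₗ‖²)⁻¹`, with `q z i i = 0`. -/
noncomputable def tsneQ {n h : ℕ} (z : Fin n → EuclideanSpace ℝ (Fin h))
    (i j : Fin n) : ℝ :=
  if i = j then 0
  else (1 + ‖z i - z j‖ ^ 2)⁻¹ /
    ∑ k, ∑ l ∈ Finset.univ.filter (fun l => l ≠ k), (1 + ‖z k - z l‖ ^ 2)⁻¹

/-- t-SNE cost: `c₃(z) = ∑ᵢ ∑_{j≠i} pᵢⱼ log(pᵢⱼ/qᵢⱼ(z))`. -/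
noncomputable def tsneCost {n h : ℕ} (p : Fin n → Fin n → ℝ)
    (z : Fin n → EuclideanSpace ℝ (Fin h)) : ℝ :=
  ∑ i, ∑ j ∈ Finset.univ.filter (fun j => j ≠ i),
    p i j * Real.log (p i j / tsneQ z i j)

open Function in
/-- Each ordered pair `(k, l)` with `k = i` or `l = i` contributes to the gradient of a
pairwise energy in the `i`-th point. -/
theorem hasGradientAt_sum_pairwise {ι E : Type*} [Fintype ι] [DecidableEq ι]
    [NormedAddCommGroup E] [InnerProductSpace ℝ E] [CompleteSpace E]
    (y : ι → E) (i : ι) (φ : ι → ι → ℝ → ℝ) (φ' : ι → ι → ℝ)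
    (hφ : ∀ k l, HasDerivAt (φ k l) (φ' k l) (‖y k - y l‖ ^ 2))
    (hsymm : ∀ k l, φ' k l = φ' l k) :
    HasGradientAt
      (fun u => ∑ k, ∑ l ∈ Finset.univ.filter (fun l => l ≠ k),
        φ k l (‖update y i u k - update y i u l‖ ^ 2))
      ((4 : ℝ) • ∑ j, φ' i j • (y i - y j)) (y i) := by
  have hcoord (k : ι) : HasFDerivAt (fun u => update y i u k)
      (if k = i then ContinuousLinearMap.id ℝ E else 0) (y i) := by
    split_ifs with h
    · subst h
      simp only [update_self]
      exact hasFDerivAt_id (y k)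
    · simpa [update_of_ne h] using hasFDerivAt_const (𝕜 := ℝ) (y k) (y i)
  have hterm (k l : ι) : HasFDerivAt
      (fun u => φ k l (‖update y i u k - update y i u l‖ ^ 2))
      (φ' k l • ((2 : ℕ) • (innerSL ℝ (y k - y l)).comp
        ((if k = i then ContinuousLinearMap.id ℝ E else 0) -
          (if l = i then ContinuousLinearMap.id ℝ E else 0)))) (y i) := by
    have h := ((hcoord k).sub (hcoord l)).norm_sq
    simp only [Pi.sub_apply, update_eq_self] at h
    refine HasDerivAt.comp_hasFDerivAt (y i) ?_ h
    simpa using hφ k l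
  rw [hasGradientAt_iff_hasFDerivAt]
  refine (HasFDerivAt.fun_sum fun k _ => HasFDerivAt.fun_sum fun l _ => hterm k l).congr_fderiv ?_
  ext v
  have hdiag (k : ι) : (φ' k k • ((2 : ℕ) • (innerSL ℝ (y k - y k)).comp
        ((if k = i then ContinuousLinearMap.id ℝ E else 0) -
          (if k = i then ContinuousLinearMap.id ℝ E else 0)))) = 0 := by simp
  have hfull (k : ι) : (∑ l ∈ Finset.univ.filter (fun l => l ≠ k),
      (φ' k l • ((2 : ℕ) • (innerSL ℝ (y k - y l)).comp
        ((if k = i then ContinuousLinearMap.id ℝ E else 0) -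
          (if l = i then ContinuousLinearMap.id ℝ E else 0))))) =
      ∑ l, (φ' k l • ((2 : ℕ) • (innerSL ℝ (y k - y l)).comp
        ((if k = i then ContinuousLinearMap.id ℝ E else 0) -
          (if l = i then ContinuousLinearMap.id ℝ E else 0)))) := by
    refine Finset.sum_subset (Finset.filter_subset _ _) fun l _ hl => ?_
    obtain rfl : l = k := by simpa using hl
    exact hdiag l
  have happly (k l : ι) : (φ' k l • ((2 : ℕ) • (innerSL ℝ (y k - y l)).comp
        ((if k = i then ContinuousLinearMap.id ℝ E else 0) -
          (if l = i then ContinuousLinearMap.id ℝ E else 0)))) v =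
      (if k = i then 2 * (φ' k l * inner ℝ (y k - y l) v) else 0) +
      (if l = i then 2 * (φ' l k * inner ℝ (y l - y k) v) else 0) := by
    rw [hsymm l k, ← neg_sub (y k) (y l), inner_neg_left]
    split_ifs <;> simp [inner_sub_left] <;> ring
  simp only [hfull, sum_apply, happly, Finset.sum_add_distrib]
  rw [Finset.sum_comm (f := fun k l => if k = i then 2 * (φ' k l * inner ℝ (y k - y l) v) else 0)]
  simp [inner_sub_left, ← Finset.mul_sum]
  ring

/-- With total mass one, the cost splits into an entropy, an attractive and a
log-partition term. -/
theorem tsneCost_eq {n h : ℕ} (p : Fin n → Fin n → ℝ)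
    (hpos : ∀ i j, i ≠ j → 0 < p i j)
    (hsum : ∑ i, ∑ j ∈ Finset.univ.filter (fun j => j ≠ i), p i j = 1)
    (z : Fin n → EuclideanSpace ℝ (Fin h))
    (hZ : 0 < ∑ k, ∑ l ∈ Finset.univ.filter (fun l => l ≠ k), (1 + ‖z k - z l‖ ^ 2)⁻¹) :
    tsneCost p z =
      (∑ k, ∑ l ∈ Finset.univ.filter (fun l => l ≠ k),
        (p k l * Real.log (p k l) + p k l * Real.log (1 + ‖z k - z l‖ ^ 2))) +
      Real.log (∑ k, ∑ l ∈ Finset.univ.filter (fun l => l ≠ k), (1 + ‖z k - z l‖ ^ 2)⁻¹) := by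
  unfold tsneCost tsneQ
  set Z := ∑ k, ∑ l ∈ Finset.univ.filter (fun l => l ≠ k), (1 + ‖z k - z l‖ ^ 2)⁻¹
  have hlogZ : Real.log Z =
      ∑ k, ∑ l ∈ Finset.univ.filter (fun l => l ≠ k), p k l * Real.log Z := by
    simp only [← Finset.sum_mul, hsum, one_mul]
  rw [hlogZ]
  simp only [← Finset.sum_add_distrib]
  refine Finset.sum_congr rfl fun k _ => Finset.sum_congr rfl fun l hl => ?_
  have hkl : k ≠ l := by simpa [eq_comm] using hl
  have hw : 0 < 1 + ‖z k - z l‖ ^ 2 := by positivity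
  have hp := hpos k l hkl
  rw [if_neg hkl, Real.log_div hp.ne' (div_pos (inv_pos.2 hw) hZ).ne',
    Real.log_div (inv_pos.2 hw).ne' hZ.ne', Real.log_inv]
  ring

theorem sum_cauchyKernel_pos {n h : ℕ} (hn : 2 ≤ n) (z : Fin n → EuclideanSpace ℝ (Fin h)) :
    0 < ∑ k, ∑ l ∈ Finset.univ.filter (fun l => l ≠ k), (1 + ‖z k - z l‖ ^ 2)⁻¹ := by
  have : NeZero n := ⟨by omega⟩
  have : Nontrivial (Fin n) := Fin.nontrivial_iff_two_le.2 hn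
  refine Finset.sum_pos (fun k _ => Finset.sum_pos (fun l _ => by positivity) ?_)
    Finset.univ_nonempty
  obtain ⟨l, hl⟩ := exists_ne k
  exact ⟨l, by simpa using hl⟩

/-- The gradient of the t-SNE cost with respect to the embedding point `yᵢ` is
`4 ∑ⱼ (pᵢⱼ − qᵢⱼ)(1 + ‖yᵢ−yⱼ‖²)⁻¹(yᵢ − yⱼ)`. -/
theorem tsne_gradient (n h : ℕ) (hn : 2 ≤ n) (hh : 1 ≤ h)
    (y : Fin n → EuclideanSpace ℝ (Fin h)) (p : Fin n → Fin n → ℝ)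
    (hdiag : ∀ i, p i i = 0)
    (hsymm : ∀ i j, p i j = p j i)
    (hpos : ∀ i j, i ≠ j → 0 < p i j)
    (hsum : ∑ i, ∑ j ∈ Finset.univ.filter (fun j => j ≠ i), p i j = 1)
    (i : Fin n) :
    gradient (fun u => tsneCost p (Function.update y i u)) (y i) =
      (4 : ℝ) • ∑ j : Fin n,
        ((p i j - tsneQ y i j) * (1 + ‖y i - y j‖ ^ 2)⁻¹) • (y i - y j) := by
  have hw (k l : Fin n) : 1 + ‖y k - y l‖ ^ 2 ≠ 0 := by positivity
  have hlin (k l : Fin n) : HasDerivAt (fun t : ℝ => 1 + t) 1 (‖y k - y l‖ ^ 2) :=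
    (hasDerivAt_id _).const_add 1
  have hattr := hasGradientAt_sum_pairwise y i
    (fun k l t => p k l * Real.log (p k l) + p k l * Real.log (1 + t))
    (fun k l => p k l * (1 / (1 + ‖y k - y l‖ ^ 2)))
    (fun k l => (((hlin k l).log (hw k l)).const_mul _).const_add _)
    (fun k l => by rw [hsymm, norm_sub_rev])
  have hpart := hasGradientAt_sum_pairwise y i (fun _ _ t => (1 + t)⁻¹)
    (fun k l => -1 / (1 + ‖y k - y l‖ ^ 2) ^ 2)
    (fun k l => (hlin k l).fun_inv (hw k l))
    (fun k l => by rw [norm_sub_rev])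
  have hZ := sum_cauchyKernel_pos hn y
  have hlog := hpart.hasFDerivAt.log (by simpa using hZ.ne')
  have hcost := hattr.hasFDerivAt.add hlog
  rw [funext fun u =>
    tsneCost_eq p hpos hsum (Function.update y i u) (sum_cauchyKernel_pos hn _)]
  refine HasGradientAt.gradient (hasGradientAt_iff_hasFDerivAt.2 (hcost.congr_fderiv ?_))
  simp only [Function.update_eq_self]
  rw [← map_smul, ← map_add]
  congr 1
  rw [smul_comm _ (4 : ℝ), ← smul_add, Finset.smul_sum, ← Finset.sum_add_distrib]
  congr 1
  refine Finset.sum_congr rfl fun j _ => ?_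
  by_cases hij : i = j
  · simp [hij]
  · rw [smul_smul, ← add_smul, tsneQ, if_neg hij]
    congr 1
    field_simp
    ring
end

section
/- Fix integers n ≥ 2, h ≥ 1, a real degree of freedom δ > 0, points y₁,…,yₙ in ℝ^h, and symmetric target probabilities p : Fin n → Fin n → ℝ with pᵢᵢ = 0, pᵢⱼ = pⱼᵢ, pᵢⱼ > 0 for i ≠ j, and ∑_{(i,j): i≠j} pᵢⱼ = 1. Define qᵢⱼ(y) = (1 + ‖yᵢ−yⱼ‖²/δ)^{−(δ+1)/2} / ∑_{(k,l): k≠l} (1 + ‖yₖ−yₗ‖²/δ)^{−(δ+1)/2} and the cost c₃(y) = ∑ᵢ ∑_{j≠i} pᵢⱼ log(pᵢⱼ / qᵢⱼ(y)). Then for every index i, the gradient of the map u ↦ c₃(y with yᵢ replaced by u), evaluated at yᵢ, equals (2(δ+1)/δ) ∑_{j=1}^n (pᵢⱼ − qᵢⱼ)(1 + ‖yᵢ−yⱼ‖²/δ)⁻¹ (yᵢ − yⱼ), where qᵢⱼ is evaluated at the given y and pᵢᵢ = qᵢᵢ = 0. -/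
/-- t-SNE embedding-space probability with general degrees of freedom `δ`:
`q z i j = (1 + ‖zᵢ-zⱼ‖²/δ)^{−(δ+1)/2} / ∑_{(k,l): k≠l} (1 + ‖zₖ-zₗ‖²/δ)^{−(δ+1)/2}`,
with `q z i i = 0`.  Powers are real powers (`Real.rpow`). -/
noncomputable def tsneGenQ {n h : ℕ} (δ : ℝ) (z : Fin n → EuclideanSpace ℝ (Fin h))
    (i j : Fin n) : ℝ :=
  if i = j then 0
  else (1 + ‖z i - z j‖ ^ 2 / δ) ^ (-(δ + 1) / 2 : ℝ) /
    ∑ k, ∑ l ∈ Finset.univ.filter (fun l => l ≠ k),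
      (1 + ‖z k - z l‖ ^ 2 / δ) ^ (-(δ + 1) / 2 : ℝ)

/-- t-SNE cost with general degrees of freedom:
`c₃(z) = ∑ᵢ ∑_{j≠i} pᵢⱼ log(pᵢⱼ/qᵢⱼ(z))`. -/
noncomputable def tsneGenCost {n h : ℕ} (δ : ℝ) (p : Fin n → Fin n → ℝ)
    (z : Fin n → EuclideanSpace ℝ (Fin h)) : ℝ :=
  ∑ i, ∑ j ∈ Finset.univ.filter (fun j => j ≠ i),
    p i j * Real.log (p i j / tsneGenQ δ z i j)

section TsneGenGradient

variable {n h : ℕ}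

/-- The derivative of `z ↦ ‖zₖ - zₗ‖² / 2`. -/
noncomputable def halfSqDistDeriv (z : Fin n → EuclideanSpace ℝ (Fin h)) (k l : Fin n) :
    (Fin n → EuclideanSpace ℝ (Fin h)) →L[ℝ] ℝ :=
  (innerSL ℝ (z k - z l)).comp
    (ContinuousLinearMap.proj (R := ℝ) (φ := fun _ : Fin n => EuclideanSpace ℝ (Fin h)) k
      - ContinuousLinearMap.proj l)

lemma halfSqDistDeriv_apply (z w : Fin n → EuclideanSpace ℝ (Fin h)) (k l : Fin n) :
    halfSqDistDeriv z k l w = inner ℝ (z k - z l) (w k - w l) := rfl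

lemma one_add_sq_dist_div_pos {δ : ℝ} (hδ : 0 < δ) (z : Fin n → EuclideanSpace ℝ (Fin h))
    (k l : Fin n) : 0 < 1 + ‖z k - z l‖ ^ 2 / δ := by positivity

lemma hasFDerivAt_one_add_sq_dist_div (δ : ℝ) (z : Fin n → EuclideanSpace ℝ (Fin h))
    (k l : Fin n) :
    HasFDerivAt (fun z : Fin n → EuclideanSpace ℝ (Fin h) => 1 + ‖z k - z l‖ ^ 2 / δ)
      ((2 / δ) • halfSqDistDeriv z k l) z := by
  have h1 : HasFDerivAt (fun z : Fin n → EuclideanSpace ℝ (Fin h) => z k - z l)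
      (ContinuousLinearMap.proj (R := ℝ) (φ := fun _ : Fin n => EuclideanSpace ℝ (Fin h)) k
        - ContinuousLinearMap.proj l) z :=
    (hasFDerivAt_apply k z).sub (hasFDerivAt_apply l z)
  have h2 := (h1.norm_sq.mul_const δ⁻¹).const_add 1
  simp only [← div_eq_mul_inv] at h2
  refine h2.congr_fderiv ?_
  ext w
  simp [halfSqDistDeriv]
  ring

lemma hasFDerivAt_studentKernel {δ : ℝ} (hδ : 0 < δ) (z : Fin n → EuclideanSpace ℝ (Fin h))
    (k l : Fin n) :
    HasFDerivAt (fun z : Fin n → EuclideanSpace ℝ (Fin h) =>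
        (1 + ‖z k - z l‖ ^ 2 / δ) ^ (-(δ + 1) / 2 : ℝ))
      ((-((δ + 1) / δ) * ((1 + ‖z k - z l‖ ^ 2 / δ) ^ (-(δ + 1) / 2 : ℝ) *
        (1 + ‖z k - z l‖ ^ 2 / δ)⁻¹)) • halfSqDistDeriv z k l) z := by
  have hs := one_add_sq_dist_div_pos hδ z k l
  refine ((hasFDerivAt_one_add_sq_dist_div δ z k l).rpow_const (p := -(δ + 1) / 2)
    (Or.inl hs.ne')).congr_fderiv ?_
  rw [smul_smul, Real.rpow_sub_one hs.ne', div_eq_mul_inv _ (1 + _)]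
  congr 1
  ring

/-- The normalizing constant of `tsneGenQ`. -/
noncomputable def tsneGenPartition (δ : ℝ) (z : Fin n → EuclideanSpace ℝ (Fin h)) : ℝ :=
  ∑ k, ∑ l ∈ Finset.univ.filter (fun l => l ≠ k),
    (1 + ‖z k - z l‖ ^ 2 / δ) ^ (-(δ + 1) / 2 : ℝ)

lemma tsneGenQ_of_ne (δ : ℝ) (z : Fin n → EuclideanSpace ℝ (Fin h)) {k l : Fin n}
    (hkl : k ≠ l) :
    tsneGenQ δ z k l =
      (1 + ‖z k - z l‖ ^ 2 / δ) ^ (-(δ + 1) / 2 : ℝ) / tsneGenPartition δ z :=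
  if_neg hkl

lemma tsneGenQ_comm (δ : ℝ) (z : Fin n → EuclideanSpace ℝ (Fin h)) (k l : Fin n) :
    tsneGenQ δ z k l = tsneGenQ δ z l k := by
  simp only [tsneGenQ, eq_comm (a := k), norm_sub_rev (z k)]

lemma tsneGenPartition_pos {δ : ℝ} (hδ : 0 < δ) (z : Fin n → EuclideanSpace ℝ (Fin h))
    {k l : Fin n} (hkl : k ≠ l) : 0 < tsneGenPartition δ z := by
  have hw (a b : Fin n) : 0 < (1 + ‖z a - z b‖ ^ 2 / δ) ^ (-(δ + 1) / 2 : ℝ) :=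
    Real.rpow_pos_of_pos (one_add_sq_dist_div_pos hδ z a b) _
  refine Finset.sum_pos' (fun a _ => Finset.sum_nonneg fun b _ => (hw a b).le)
    ⟨k, Finset.mem_univ k, Finset.sum_pos (fun b _ => hw k b) ⟨l, ?_⟩⟩
  simpa using hkl.symm

lemma hasFDerivAt_tsneGenPartition {δ : ℝ} (hδ : 0 < δ)
    (z : Fin n → EuclideanSpace ℝ (Fin h)) :
    HasFDerivAt (tsneGenPartition δ)
      (∑ k, ∑ l ∈ Finset.univ.filter (fun l => l ≠ k),
        (-((δ + 1) / δ) * ((1 + ‖z k - z l‖ ^ 2 / δ) ^ (-(δ + 1) / 2 : ℝ) *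
          (1 + ‖z k - z l‖ ^ 2 / δ)⁻¹)) • halfSqDistDeriv z k l) z :=
  HasFDerivAt.fun_sum fun k _ => HasFDerivAt.fun_sum fun l _ => hasFDerivAt_studentKernel hδ z k l

lemma log_div_tsneGenQ {δ : ℝ} (hδ : 0 < δ) (z : Fin n → EuclideanSpace ℝ (Fin h))
    {k l : Fin n} (hkl : k ≠ l) {a : ℝ} (ha : a ≠ 0) :
    Real.log (a / tsneGenQ δ z k l) =
      Real.log a + (δ + 1) / 2 * Real.log (1 + ‖z k - z l‖ ^ 2 / δ) +
        Real.log (tsneGenPartition δ z) := by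
  have hs := one_add_sq_dist_div_pos hδ z k l
  have hw := Real.rpow_pos_of_pos hs (-(δ + 1) / 2)
  have hZ := tsneGenPartition_pos hδ z hkl
  rw [tsneGenQ_of_ne δ z hkl, Real.log_div ha (div_pos hw hZ).ne', Real.log_div hw.ne' hZ.ne',
    Real.log_rpow hs]
  ring

/-- The full derivative of the t-SNE cost with respect to all the embedding points. -/
lemma hasFDerivAt_tsneGenCost {δ : ℝ} (hδ : 0 < δ) {p : Fin n → Fin n → ℝ}
    (hpos : ∀ i j, i ≠ j → 0 < p i j)
    (hsum : ∑ i, ∑ j ∈ Finset.univ.filter (fun j => j ≠ i), p i j = 1)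
    (z : Fin n → EuclideanSpace ℝ (Fin h)) :
    HasFDerivAt (tsneGenCost δ p)
      (((δ + 1) / δ) • ∑ k, ∑ l ∈ Finset.univ.filter (fun l => l ≠ k),
        ((p k l - tsneGenQ δ z k l) * (1 + ‖z k - z l‖ ^ 2 / δ)⁻¹) • halfSqDistDeriv z k l)
      z := by
  have hterm : ∀ k, ∀ l ∈ Finset.univ.filter (fun l => l ≠ k),
      HasFDerivAt (fun z : Fin n → EuclideanSpace ℝ (Fin h) =>
          p k l * Real.log (p k l / tsneGenQ δ z k l))
        ((p k l * ((δ + 1) / δ * (1 + ‖z k - z l‖ ^ 2 / δ)⁻¹)) • halfSqDistDeriv z k l +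
          p k l • ((tsneGenPartition δ z)⁻¹ •
            ∑ k, ∑ l ∈ Finset.univ.filter (fun l => l ≠ k),
              (-((δ + 1) / δ) * ((1 + ‖z k - z l‖ ^ 2 / δ) ^ (-(δ + 1) / 2 : ℝ) *
                (1 + ‖z k - z l‖ ^ 2 / δ)⁻¹)) • halfSqDistDeriv z k l)) z := by
    intro k l hl
    have hkl : k ≠ l := (Finset.mem_filter.mp hl).2.symm
    have hs := (hasFDerivAt_one_add_sq_dist_div δ z k l).log
      (one_add_sq_dist_div_pos hδ z k l).ne'
    have hZ := (hasFDerivAt_tsneGenPartition hδ z).log (tsneGenPartition_pos hδ z hkl).ne'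
    have hd := ((((hs.const_mul ((δ + 1) / 2)).const_add (Real.log (p k l))).add hZ).const_mul
      (p k l))
    simp only [log_div_tsneGenQ hδ _ hkl (hpos k l hkl).ne']
    refine hd.congr_fderiv ?_
    rw [smul_add]
    congr 1
    simp only [smul_smul]
    congr 1
    field_simp
  have hcost := HasFDerivAt.fun_sum (u := Finset.univ) fun k _ => HasFDerivAt.fun_sum (hterm k)
  refine hcost.congr_fderiv ?_
  simp only [Finset.sum_add_distrib, ← Finset.sum_smul, hsum, one_smul]
  simp only [Finset.smul_sum, ← Finset.sum_add_distrib]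
  refine Finset.sum_congr rfl fun k _ => Finset.sum_congr rfl fun l hl => ?_
  rw [tsneGenQ_of_ne δ z (Finset.mem_filter.mp hl).2.symm]
  simp only [smul_smul, ← add_smul]
  congr 1
  ring

/-- Only the pairs containing `i` contribute to the derivative in the `i`-th point. -/
lemma sum_mul_halfSqDistDeriv_single {a : Fin n → Fin n → ℝ} (ha : ∀ k l, a k l = a l k)
    (z : Fin n → EuclideanSpace ℝ (Fin h)) (i : Fin n) (v : EuclideanSpace ℝ (Fin h)) :
    ∑ k, ∑ l ∈ Finset.univ.filter (fun l => l ≠ k),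
        a k l * halfSqDistDeriv z k l (Pi.single i v) =
      2 * ∑ l, a i l * inner ℝ (z i - z l) v := by
  have hfull (k : Fin n) : ∑ l ∈ Finset.univ.filter (fun l => l ≠ k),
        a k l * halfSqDistDeriv z k l (Pi.single i v) =
      ∑ l, a k l * halfSqDistDeriv z k l (Pi.single i v) := by
    refine Finset.sum_filter_of_ne fun l _ hl hlk => hl ?_
    simp [hlk, halfSqDistDeriv_apply]
  have hsingle (x : EuclideanSpace ℝ (Fin h)) (k : Fin n) :
      inner ℝ x ((Pi.single i v : Fin n → EuclideanSpace ℝ (Fin h)) k) =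
        if k = i then inner ℝ x v else 0 := by
    by_cases hk : k = i
    · subst hk; simp
    · simp [hk]
  simp only [hfull]
  simp only [halfSqDistDeriv_apply, inner_sub_right, hsingle, mul_sub,
    Finset.sum_sub_distrib, mul_ite, mul_zero]
  rw [Finset.sum_comm (f := fun k l => if k = i then a k l * inner ℝ (z k - z l) v else 0)]
  simp only [Finset.sum_ite_eq', Finset.mem_univ, if_true]
  rw [two_mul, sub_eq_add_neg, ← Finset.sum_neg_distrib]
  congr 1
  refine Finset.sum_congr rfl fun l _ => ?_
  rw [ha l i, ← neg_sub (z i), inner_neg_left]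
  ring

end TsneGenGradient

/-- The gradient of the t-SNE cost with general degrees of freedom `δ` with respect to the
embedding point `yᵢ` is `(2(δ+1)/δ) ∑ⱼ (pᵢⱼ − qᵢⱼ)(1 + ‖yᵢ−yⱼ‖²/δ)⁻¹(yᵢ − yⱼ)`. -/
theorem tsne_general_gradient (n h : ℕ) (hn : 2 ≤ n) (hh : 1 ≤ h)
    (δ : ℝ) (hδ : 0 < δ)
    (y : Fin n → EuclideanSpace ℝ (Fin h)) (p : Fin n → Fin n → ℝ)
    (hdiag : ∀ i, p i i = 0)
    (hsymm : ∀ i j, p i j = p j i)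
    (hpos : ∀ i j, i ≠ j → 0 < p i j)
    (hsum : ∑ i, ∑ j ∈ Finset.univ.filter (fun j => j ≠ i), p i j = 1)
    (i : Fin n) :
    gradient (fun u => tsneGenCost δ p (Function.update y i u)) (y i) =
      (2 * (δ + 1) / δ) • ∑ j : Fin n,
        ((p i j - tsneGenQ δ y i j) * (1 + ‖y i - y j‖ ^ 2 / δ)⁻¹) • (y i - y j) := by
  have hupd : HasFDerivAt (Function.update y i)
      (.pi (Pi.single i (.id ℝ (EuclideanSpace ℝ (Fin h))))) (y i) := hasFDerivAt_update y (y i)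
  have hcost := hasFDerivAt_tsneGenCost hδ hpos hsum (Function.update y i (y i))
  have hcomp := hcost.comp (y i) hupd
  rw [Function.update_eq_self] at hcomp
  refine HasGradientAt.gradient (hasGradientAt_iff_hasFDerivAt.mpr (hcomp.congr_fderiv ?_))
  ext1 v
  have hv : ContinuousLinearMap.pi (Pi.single i (.id ℝ (EuclideanSpace ℝ (Fin h)))) v =
      (Pi.single i v : Fin n → EuclideanSpace ℝ (Fin h)) := by
    ext1 k
    by_cases hk : k = i
    · subst hk; simp
    · simp [hk]
  have hsingle := sum_mul_halfSqDistDeriv_single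
    (a := fun k l => (p k l - tsneGenQ δ y k l) * (1 + ‖y k - y l‖ ^ 2 / δ)⁻¹)
    (fun k l => by rw [hsymm, tsneGenQ_comm, norm_sub_rev]) y i v
  simp only [ContinuousLinearMap.comp_apply, hv, smul_apply,
    sum_apply, smul_eq_mul, InnerProductSpace.toDual_apply_apply,
    real_inner_smul_left, sum_inner, hsingle]
  ring
end

section
/- Fix integers n ≥ 2, h ≥ 1, points y₁,…,yₙ in ℝ^h with pairwise squared distances zᵢⱼ² = ‖yᵢ−yⱼ‖², and symmetric target probabilities p : Fin n → Fin n → ℝ with pᵢᵢ = 0, pᵢⱼ = pⱼᵢ, pᵢⱼ > 0 for i ≠ j, and ∑_{(i,j): i≠j} pᵢⱼ = 1. For δ > 0 define qᵢⱼ(δ) = (1 + zᵢⱼ²/δ)^{−(δ+1)/2} / ∑_{(k,l): k≠l} (1 + zₖₗ²/δ)^{−(δ+1)/2} and c₃(δ) = ∑ᵢ ∑_{j≠i} pᵢⱼ log(pᵢⱼ / qᵢⱼ(δ)). Then c₃ is differentiable at every δ > 0 with derivative dc₃/dδ = ∑_{(i,j): i≠j} ( −(1+δ) zᵢⱼ²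 / (2δ² (1 + zᵢⱼ²/δ)) + (1/2) log(1 + zᵢⱼ²/δ) ) (pᵢⱼ − qᵢⱼ(δ)). -/
/-- t-SNE embedding-space probability with general degrees of freedom `δ`, as a function
of `δ` for fixed embedding points `y`:
`q δ i j = (1 + zᵢⱼ²/δ)^{−(δ+1)/2} / ∑_{(k,l): k≠l} (1 + zₖₗ²/δ)^{−(δ+1)/2}`
where `zᵢⱼ² = ‖yᵢ−yⱼ‖²`, with `q δ i i = 0`. Powers are real powers (`Real.rpow`). -/
noncomputable def tsneDegQ {n h : ℕ} (y : Fin n → EuclideanSpace ℝ (Fin h))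
    (δ : ℝ) (i j : Fin n) : ℝ :=
  if i = j then 0
  else (1 + ‖y i - y j‖ ^ 2 / δ) ^ (-(δ + 1) / 2 : ℝ) /
    ∑ k, ∑ l ∈ Finset.univ.filter (fun l => l ≠ k),
      (1 + ‖y k - y l‖ ^ 2 / δ) ^ (-(δ + 1) / 2 : ℝ)

/-- t-SNE cost with general degrees of freedom, viewed as a real function of `δ`
for fixed embedding points `y`. -/
noncomputable def tsneDegCost {n h : ℕ} (p : Fin n → Fin n → ℝ)
    (y : Fin n → EuclideanSpace ℝ (Fin h)) (δ : ℝ) : ℝ :=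
  ∑ i, ∑ j ∈ Finset.univ.filter (fun j => j ≠ i),
    p i j * Real.log (p i j / tsneDegQ y δ i j)

/-- The derivative of the logarithm of the Student-t kernel in the degree of freedom. -/
lemma hasDerivAt_studentT_log {a δ : ℝ} (ha : 0 ≤ a) (hδ : 0 < δ) :
    HasDerivAt (fun t : ℝ => -(t + 1) / 2 * Real.log (1 + a / t))
      (-(-(1 + δ) * a / (2 * δ ^ 2 * (1 + a / δ)) + (1 / 2) * Real.log (1 + a / δ))) δ := by
  have hb : 0 < 1 + a / δ := by positivity
  have hinner : HasDerivAt (fun t : ℝ => 1 + a / t) (-a / δ ^ 2) δ := by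
    have := ((hasDerivAt_const δ a).fun_div (hasDerivAt_id' δ) hδ.ne').const_add 1
    simpa using this
  have hexp : HasDerivAt (fun t : ℝ => -(t + 1) / 2) (-1 / 2) δ :=
    (((hasDerivAt_id' δ).add_const 1).fun_neg).div_const 2
  refine (hexp.fun_mul (hinner.log hb.ne')).congr_deriv ?_
  have h1 : δ + a ≠ 0 := by positivity
  field_simp
  ring

/-- The derivative of the Student-t kernel in the degree of freedom. -/
lemma hasDerivAt_studentT {a δ : ℝ} (ha : 0 ≤ a) (hδ : 0 < δ) :
    HasDerivAt (fun t : ℝ => (1 + a / t) ^ (-(t + 1) / 2 : ℝ))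
      (-(-(1 + δ) * a / (2 * δ ^ 2 * (1 + a / δ)) + (1 / 2) * Real.log (1 + a / δ)) *
        (1 + a / δ) ^ (-(δ + 1) / 2 : ℝ)) δ := by
  have hpow : ∀ t : ℝ, 0 < t →
      (1 + a / t) ^ (-(t + 1) / 2 : ℝ) = Real.exp (-(t + 1) / 2 * Real.log (1 + a / t)) := by
    intro t ht
    rw [Real.rpow_def_of_pos (by positivity), mul_comm]
  have hexp := (hasDerivAt_studentT_log ha hδ).exp
  rw [← hpow δ hδ, mul_comm] at hexp
  refine hexp.congr_of_eventuallyEq ?_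
  filter_upwards [lt_mem_nhds hδ] with t ht using hpow t ht

/-- The normalizing sum of the Student-t kernels is positive. -/
lemma studentT_sum_pos {n h : ℕ} (hn : 2 ≤ n) (y : Fin n → EuclideanSpace ℝ (Fin h))
    {δ : ℝ} (hδ : 0 < δ) :
    0 < ∑ k, ∑ l ∈ Finset.univ.filter (fun l => l ≠ k),
      (1 + ‖y k - y l‖ ^ 2 / δ) ^ (-(δ + 1) / 2 : ℝ) := by
  have : Nontrivial (Fin n) := Fin.nontrivial_iff_two_le.mpr hn
  refine Finset.sum_pos (fun k _ => Finset.sum_pos (fun l _ => by positivity) ?_)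
    Finset.univ_nonempty
  obtain ⟨l, hl⟩ := exists_ne k
  exact ⟨l, by simpa using hl⟩

/-- For fixed embedding points, the t-SNE cost with general degrees of freedom is
differentiable in `δ > 0` with derivative
`∑_{i≠j} ( −(1+δ) zᵢⱼ² / (2δ²(1+zᵢⱼ²/δ)) + (1/2) log(1+zᵢⱼ²/δ) ) (pᵢⱼ − qᵢⱼ(δ))`. -/
theorem tsne_degree_derivative (n h : ℕ) (hn : 2 ≤ n) (hh : 1 ≤ h)
    (y : Fin n → EuclideanSpace ℝ (Fin h)) (p : Fin n → Fin n → ℝ)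
    (hdiag : ∀ i, p i i = 0)
    (hsymm : ∀ i j, p i j = p j i)
    (hpos : ∀ i j, i ≠ j → 0 < p i j)
    (hsum : ∑ i, ∑ j ∈ Finset.univ.filter (fun j => j ≠ i), p i j = 1) :
    ∀ δ : ℝ, 0 < δ →
      HasDerivAt (tsneDegCost p y)
        (∑ i, ∑ j ∈ Finset.univ.filter (fun j => j ≠ i),
          (-(1 + δ) * ‖y i - y j‖ ^ 2 / (2 * δ ^ 2 * (1 + ‖y i - y j‖ ^ 2 / δ))
            + (1 / 2) * Real.log (1 + ‖y i - y j‖ ^ 2 / δ))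
          * (p i j - tsneDegQ y δ i j)) δ := by
  intro δ hδ
  set G : Fin n → Fin n → ℝ := fun i j =>
    -(1 + δ) * ‖y i - y j‖ ^ 2 / (2 * δ ^ 2 * (1 + ‖y i - y j‖ ^ 2 / δ))
      + (1 / 2) * Real.log (1 + ‖y i - y j‖ ^ 2 / δ)
  set Z : ℝ → ℝ := fun t => ∑ k, ∑ l ∈ Finset.univ.filter (fun l => l ≠ k),
    (1 + ‖y k - y l‖ ^ 2 / t) ^ (-(t + 1) / 2 : ℝ)
  set Z' : ℝ := ∑ k, ∑ l ∈ Finset.univ.filter (fun l => l ≠ k),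
    -G k l * (1 + ‖y k - y l‖ ^ 2 / δ) ^ (-(δ + 1) / 2 : ℝ) with hZ'
  have hZpos : ∀ t : ℝ, 0 < t → 0 < Z t := fun t ht => studentT_sum_pos hn y ht
  have hZderiv : HasDerivAt Z Z' δ :=
    HasDerivAt.fun_sum fun k _ => HasDerivAt.fun_sum fun l _ =>
      hasDerivAt_studentT (sq_nonneg ‖y k - y l‖) hδ
  have hcost : ∀ t : ℝ, 0 < t → tsneDegCost p y t =
      ∑ i, ∑ j ∈ Finset.univ.filter (fun j => j ≠ i), p i j *
        (Real.log (p i j) - -(t + 1) / 2 * Real.log (1 + ‖y i - y j‖ ^ 2 / t)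
          + Real.log (Z t)) := by
    intro t ht
    refine Finset.sum_congr rfl fun i _ => Finset.sum_congr rfl fun j hj => ?_
    have hij : i ≠ j := (Finset.mem_filter.mp hj).2.symm
    have hb : 0 < 1 + ‖y i - y j‖ ^ 2 / t := by positivity
    have hw : 0 < (1 + ‖y i - y j‖ ^ 2 / t) ^ (-(t + 1) / 2 : ℝ) := Real.rpow_pos_of_pos hb _
    have hq : tsneDegQ y t i j = (1 + ‖y i - y j‖ ^ 2 / t) ^ (-(t + 1) / 2 : ℝ) / Z t :=
      if_neg hij
    rw [hq, Real.log_div (hpos i j hij).ne' (div_pos hw (hZpos t ht)).ne',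
      Real.log_div hw.ne' (hZpos t ht).ne', Real.log_rpow hb]
    ring
  have hderiv : HasDerivAt (tsneDegCost p y)
      (∑ i, ∑ j ∈ Finset.univ.filter (fun j => j ≠ i), p i j * (G i j + Z' / Z δ)) δ := by
    refine HasDerivAt.congr_of_eventuallyEq (f := fun t =>
      ∑ i, ∑ j ∈ Finset.univ.filter (fun j => j ≠ i), p i j *
        (Real.log (p i j) - -(t + 1) / 2 * Real.log (1 + ‖y i - y j‖ ^ 2 / t)
          + Real.log (Z t))) ?_ ?_
    · refine HasDerivAt.fun_sum fun i _ => HasDerivAt.fun_sum fun j _ => ?_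
      refine HasDerivAt.const_mul (p i j) ?_
      refine HasDerivAt.fun_add ?_ (hZderiv.log (hZpos δ hδ).ne')
      simpa only [neg_neg] using
        (hasDerivAt_studentT_log (sq_nonneg ‖y i - y j‖) hδ).const_sub (Real.log (p i j))
    · filter_upwards [lt_mem_nhds hδ] with t ht using hcost t ht
  refine hderiv.congr_deriv ?_
  have hGq : ∑ i, ∑ j ∈ Finset.univ.filter (fun j => j ≠ i), G i j * tsneDegQ y δ i j =
      -(Z' / Z δ) := by
    rw [hZ', ← neg_div, ← Finset.sum_neg_distrib, Finset.sum_div]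
    refine Finset.sum_congr rfl fun i _ => ?_
    rw [← Finset.sum_neg_distrib, Finset.sum_div]
    refine Finset.sum_congr rfl fun j hj => ?_
    have hq : tsneDegQ y δ i j = (1 + ‖y i - y j‖ ^ 2 / δ) ^ (-(δ + 1) / 2 : ℝ) / Z δ :=
      if_neg (Finset.mem_filter.mp hj).2.symm
    rw [hq]
    ring
  change _ = ∑ i, ∑ j ∈ Finset.univ.filter (fun j => j ≠ i),
    G i j * (p i j - tsneDegQ y δ i j)
  simp only [mul_add, mul_sub, Finset.sum_add_distrib, Finset.sum_sub_distrib, hGq,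
    ← Finset.sum_mul, hsum, mul_comm (G _ _) (p _ _)]
  ring
end

section
/- Fix n ≥ 2, a real δ > 0, and symmetric target probabilities p : Fin n → Fin n → ℝ with pₖₖ = 0, pₖₗ > 0 for k ≠ l, and ∑_{(k,l): k≠l} pₖₗ = 1. For R : Fin n → Fin n → ℝ with nonnegative entries define qₖₗ(R) = (1 + Rₖₗ/δ)^{−(δ+1)/2} / ∑_{(m,f): m≠f} (1 + R_{mf}/δ)^{−(δ+1)/2} for k ≠ l, and c(R) = ∑_{(k,l): k≠l} pₖₗ log(pₖₗ / qₖₗ(R)). Then for every pair (i,j) with i ≠ j, the partial derivative of c with respect to the entry Rᵢⱼ equals ((δ+1)/(2δ)) (1 + Rᵢⱼ/δ)⁻¹ (pᵢⱼ − qᵢⱼ(R)). -/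
open Finset in
theorem sum_offDiag_ite_eq {ι M : Type*} [Fintype ι] [DecidableEq ι] [AddCommMonoid M]
    {i j : ι} (hij : i ≠ j) (f : ι → ι → M) :
    ∑ k, ∑ l ∈ univ.filter (fun l => l ≠ k), (if k = i ∧ l = j then f k l else 0) = f i j := by
  rw [sum_eq_single i, sum_eq_single j]
  · simp
  · intro l _ hl
    simp [hl]
  · intro h
    exact absurd (by simpa using hij.symm) h
  · intro k _ hk
    simp [hk]
  · simp

theorem hasDerivAt_update_update_apply {ι κ : Type*} [DecidableEq ι] [DecidableEq κ]
    (R : ι → κ → ℝ) (i k : ι) (j l : κ) (x : ℝ) :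
    HasDerivAt (fun t => Function.update R i (Function.update (R i) j t) k l)
      (if k = i ∧ l = j then 1 else 0) x := by
  by_cases hk : k = i
  · subst hk
    by_cases hl : l = j
    · subst hl
      simpa using hasDerivAt_id' x
    · simpa [hl] using hasDerivAt_const x (R k l)
  · simpa [hk] using hasDerivAt_const x (R k l)

theorem HasDerivAt.log_const_div_div {f g : ℝ → ℝ} {f' g' x a : ℝ} (hf : HasDerivAt f f' x)
    (hg : HasDerivAt g g' x) (ha : a ≠ 0) (hfx : f x ≠ 0) (hgx : g x ≠ 0) :
    HasDerivAt (fun t => Real.log (a / (f t / g t))) (g' / g x - f' / f x) x := by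
  have h := ((hasDerivAt_const x a).fun_div (hf.fun_div hg hgx) (div_ne_zero hfx hgx)).log
    (div_ne_zero ha (div_ne_zero hfx hgx))
  refine h.congr_deriv ?_
  field_simp
  ring

/-- The derivative of the Student-t kernel of the `(k, l)` entry with respect to the `(i, j)`
entry. -/
theorem hasDerivAt_studentKernel_update {ι κ : Type*} [DecidableEq ι] [DecidableEq κ]
    {δ : ℝ} (e : ℝ) (R : ι → κ → ℝ) (i k : ι) (j l : κ) (hR : 0 < 1 + R k l / δ) :
    HasDerivAt (fun t => (1 + Function.update R i (Function.update (R i) j t) k l / δ) ^ e)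
      (if k = i ∧ l = j then e / δ * (1 + R k l / δ)⁻¹ * (1 + R k l / δ) ^ e else 0)
      (R i j) := by
  have hU : Function.update R i (Function.update (R i) j (R i j)) = R := by simp
  have h := (((hasDerivAt_update_update_apply R i k j l (R i j)).div_const δ).const_add
    1).rpow_const (p := e) (Or.inl (by rw [hU]; exact hR.ne'))
  refine h.congr_deriv ?_
  rw [hU, Real.rpow_sub_one hR.ne']
  split_ifs
  · ring
  · simp


/-- Student-t-kernel softmax with degrees of freedom `δ` and a single normalizing constant
over all ordered off-diagonal pairs:
`q R k l = (1 + Rₖₗ/δ)^{−(δ+1)/2} / ∑_{(m,f): m≠f} (1 + R_{mf}/δ)^{−(δ+1)/2}`, with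
`q R k k = 0`.  Powers are real powers (`Real.rpow`). -/
noncomputable def studentQ {n : ℕ} (δ : ℝ) (R : Fin n → Fin n → ℝ) (k l : Fin n) : ℝ :=
  if k = l then 0
  else (1 + R k l / δ) ^ (-(δ + 1) / 2 : ℝ) /
    ∑ m, ∑ f ∈ Finset.univ.filter (fun f => f ≠ m), (1 + R m f / δ) ^ (-(δ + 1) / 2 : ℝ)

/-- KL divergence cost `c(R) = ∑_{(k,l): k≠l} pₖₗ log(pₖₗ / qₖₗ(R))`. -/
noncomputable def studentKLCost {n : ℕ} (δ : ℝ) (p : Fin n → Fin n → ℝ)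
    (R : Fin n → Fin n → ℝ) : ℝ :=
  ∑ k, ∑ l ∈ Finset.univ.filter (fun l => l ≠ k),
    p k l * Real.log (p k l / studentQ δ R k l)

/-- Intermediate claim of the gradient derivation for t-SNE with general degrees of
freedom: the partial derivative of `c` with respect to the entry `Rᵢⱼ` equals
`((δ+1)/(2δ)) (1 + Rᵢⱼ/δ)⁻¹ (pᵢⱼ − qᵢⱼ(R))`. -/
theorem tsne_general_entry_partial (n : ℕ) (hn : 2 ≤ n) (δ : ℝ) (hδ : 0 < δ)
    (p : Fin n → Fin n → ℝ)
    (hdiag : ∀ k, p k k = 0)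
    (hsymm : ∀ k l, p k l = p l k)
    (hpos : ∀ k l, k ≠ l → 0 < p k l)
    (hsum : ∑ k, ∑ l ∈ Finset.univ.filter (fun l => l ≠ k), p k l = 1)
    (R : Fin n → Fin n → ℝ) (hR : ∀ k l, 0 ≤ R k l)
    (i j : Fin n) (hij : i ≠ j) :
    HasDerivAt
      (fun t => studentKLCost δ p (Function.update R i (Function.update (R i) j t)))
      ((δ + 1) / (2 * δ) * (1 + R i j / δ)⁻¹ * (p i j - studentQ δ R i j)) (R i j) := by
  set e : ℝ := -(δ + 1) / 2 with he
  have hb (k l) : 0 < 1 + R k l / δ := by have := hR k l; positivity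
  have hK (k l) := hasDerivAt_studentKernel_update e R i k j l (hb k l)
  have hU : Function.update R i (Function.update (R i) j (R i j)) = R := by simp
  have hZ := HasDerivAt.fun_sum (u := Finset.univ) fun k _ =>
    HasDerivAt.fun_sum (u := Finset.univ.filter (fun l => l ≠ k)) fun l _ => hK k l
  rw [sum_offDiag_ite_eq hij fun k l => e / δ * (1 + R k l / δ)⁻¹ * (1 + R k l / δ) ^ e] at hZ
  set Z : ℝ := ∑ m, ∑ f ∈ Finset.univ.filter (fun f => f ≠ m), (1 + R m f / δ) ^ e with hZdef
  have hZpos : 0 < Z := by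
    have hnonneg (m f) : 0 ≤ (1 + R m f / δ) ^ e := (Real.rpow_pos_of_pos (hb m f) e).le
    refine Finset.sum_pos' (fun m _ => Finset.sum_nonneg fun f _ => hnonneg m f)
      ⟨i, Finset.mem_univ i, Finset.sum_pos' (fun f _ => hnonneg i f)
        ⟨j, by simpa using hij.symm, Real.rpow_pos_of_pos (hb i j) e⟩⟩
  have hc := HasDerivAt.fun_sum (u := Finset.univ) fun k _ =>
    HasDerivAt.fun_sum (u := Finset.univ.filter (fun l => l ≠ k)) fun l hl =>
      ((hK k l).log_const_div_div hZ (hpos k l (Finset.mem_filter.1 hl).2.symm).ne'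
        (by rw [hU]; exact (Real.rpow_pos_of_pos (hb k l) e).ne')
        (by rw [hU]; exact hZpos.ne')).const_mul (p k l)
  simp only [hU, ← hZdef] at hc
  have hfun : (fun t => studentKLCost δ p (Function.update R i (Function.update (R i) j t))) =
      fun t => ∑ k, ∑ l ∈ Finset.univ.filter (fun l => l ≠ k), p k l * Real.log (p k l /
        ((1 + Function.update R i (Function.update (R i) j t) k l / δ) ^ e /
          ∑ m, ∑ f ∈ Finset.univ.filter (fun f => f ≠ m),
            (1 + Function.update R i (Function.update (R i) j t) m f / δ) ^ e)) := by
    funext t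
    refine Finset.sum_congr rfl fun k _ => Finset.sum_congr rfl fun l hl => ?_
    rw [studentQ, if_neg (Finset.mem_filter.1 hl).2.symm]
  rw [hfun]
  refine hc.congr_deriv ?_
  have hsplit (k l : Fin n) (A : ℝ) :
      p k l * (A - (if k = i ∧ l = j then e / δ * (1 + R k l / δ)⁻¹ * (1 + R k l / δ) ^ e else 0) /
        (1 + R k l / δ) ^ e) =
      p k l * A - if k = i ∧ l = j then p k l * (e / δ * (1 + R k l / δ)⁻¹) else 0 := by
    have := (Real.rpow_pos_of_pos (hb k l) e).ne'
    split_ifs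
    · rw [mul_div_cancel_right₀ _ this, mul_sub]
    · simp
  simp only [hsplit, Finset.sum_sub_distrib, ← Finset.sum_mul]
  rw [hsum, sum_offDiag_ite_eq hij fun k l => p k l * (e / δ * (1 + R k l / δ)⁻¹), studentQ,
    if_neg hij, ← he, ← hZdef, show (δ + 1) / (2 * δ) = -(e / δ) by rw [he]; field_simp]
  ring
end
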